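/- arXiv:0712.2471 — 2 statements merged into one kernel-verified Lean document; each statement's English description precedes it below -/
import Mathlib

section
/- Let u, v be reals with |sin v| ≤ |cos u|. Then the coherent information of the flagged channel T^dep_(u,v) is maximized by the maximally mixed input state: for every density matrix φ on one qubit, I^c(T^dep_(u,v), φ) ≤ I^c(T^dep_(u,v), I/2). -/
open scoped Matrix Kronecker ComplexOrder

/-- A finite family of Kraus operators from input space `A` to output space `B`. -/
structure KrausFamily (A B : Type) [Fintype A] [DecidableEq A] [Fintype B] [DecidableEq B] :
    Type 1 where
  ι : Type
  [fι : Fintype ι]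
  [dι : DecidableEq ι]
  K : ι → Matrix B A ℂ

attribute [instance] KrausFamily.fι KrausFamily.dι

variable {A B : Type} [Fintype A] [DecidableEq A] [Fintype B] [DecidableEq B]

/-- The trace-preservation condition `Σ Kᵢ† Kᵢ = 1` making a Kraus family a quantum channel. -/
def KrausFamily.IsChannel (N : KrausFamily A B) : Prop :=
  ∑ i, (N.K i)ᴴ * N.K i = 1

/-- The action of a channel: `N(ρ) = Σ Kᵢ ρ Kᵢ†`. -/
noncomputable def KrausFamily.apply (N : KrausFamily A B) (ρ : Matrix A A ℂ) : Matrix B B ℂ :=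
  ∑ i, N.K i * ρ * (N.K i)ᴴ

/-- The complementary channel: `N̂(ρ)ᵢⱼ = Tr (Kᵢ ρ Kⱼ†)`. -/
noncomputable def KrausFamily.compl (N : KrausFamily A B) (ρ : Matrix A A ℂ) :
    Matrix N.ι N.ι ℂ :=
  Matrix.of fun i j => (N.K i * ρ * (N.K j)ᴴ).trace

/-- Von Neumann entropy, base 2: `S(ρ) = −Σ λⱼ log₂ λⱼ` over the eigenvalues of `ρ`
(junk value `0` for non-Hermitian matrices). -/
noncomputable def vnEntropy {n : Type} [Fintype n] [DecidableEq n] (ρ : Matrix n n ℂ) : ℝ :=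
  if h : ρ.IsHermitian then -∑ j, h.eigenvalues j * Real.logb 2 (h.eigenvalues j) else 0

/-- A density matrix: positive semidefinite with unit trace. -/
def IsDensity {n : Type} [Fintype n] (ρ : Matrix n n ℂ) : Prop :=
  ρ.PosSemidef ∧ ρ.trace = 1

/-- Coherent information of `N` at input `φ`: `I^c(N,φ) = S(N(φ)) − S(N̂(φ))`. -/
noncomputable def cohInfo (N : KrausFamily A B) (φ : Matrix A A ℂ) : ℝ :=
  vnEntropy (N.apply φ) - vnEntropy (N.compl φ)

/-- One-shot quantum capacity: `Q^{(1)}(N) = sup_φ I^c(N,φ)` over density matrices `φ`. -/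
noncomputable def Q1 (N : KrausFamily A B) : ℝ :=
  sSup {x | ∃ φ : Matrix A A ℂ, IsDensity φ ∧ x = cohInfo N φ}

/-- The `n`-th tensor power of a Kraus family, whose Kraus operators are all `n`-fold
Kronecker products of Kraus operators of `N`. -/
noncomputable def KrausFamily.pow (N : KrausFamily A B) (n : ℕ) :
    KrausFamily (Fin n → A) (Fin n → B) where
  ι := Fin n → N.ι
  K f := Matrix.of fun b a => ∏ i, N.K (f i) (b i) (a i)

/-- Quantum capacity: `Q(N) = sup_{n ≥ 1} (1/n) Q^{(1)}(N^{⊗n})`. -/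
noncomputable def Qcap (N : KrausFamily A B) : ℝ :=
  sSup {x | ∃ n : ℕ, 0 < n ∧ x = (1 / (n : ℝ)) * Q1 (N.pow n)}

/-- `N` is degradable if some channel `D` maps its output to its complementary output. -/
def KrausFamily.IsDegradable (N : KrausFamily A B) : Prop :=
  ∃ D : KrausFamily B N.ι, D.IsChannel ∧ ∀ ρ : Matrix A A ℂ, D.apply (N.apply ρ) = N.compl ρ

/-- `N` is antidegradable if some channel `D` maps its complementary output to its output. -/
def KrausFamily.IsAntidegradable (N : KrausFamily A B) : Prop :=
  ∃ D : KrausFamily N.ι B, D.IsChannel ∧ ∀ ρ : Matrix A A ℂ, D.apply (N.compl ρ) = N.apply ρ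

/-- The Hadamard matrix `H = (1/√2)[[1,1],[1,−1]]`. -/
noncomputable def Had : Matrix (Fin 2) (Fin 2) ℂ :=
  ((Real.sqrt 2)⁻¹ : ℂ) • !![1, 1; 1, -1]

/-- The phase matrix `S = diag(1, i)`. -/
def Sgate : Matrix (Fin 2) (Fin 2) ℂ := !![1, 0; 0, Complex.I]

/-- `c : Fin 24 → M₂(ℂ)` is a family of representatives of the single-qubit Clifford
group, the 24-element group (modulo global phase) generated by the Hadamard matrix and the
phase matrix: every `c i` is unitary and lies, up to a phase, in the group generated by
`H` and `S`, and every element of that group is a phase times exactly one `c i`. -/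
def IsCliffordFamily (c : Fin 24 → Matrix (Fin 2) (Fin 2) ℂ) : Prop :=
  (∀ i, c i ∈ Matrix.unitaryGroup (Fin 2) ℂ) ∧
  (∀ i, ∃ z : ℂ, z • c i ∈ Submonoid.closure {Had, Sgate}) ∧
  (∀ u ∈ Submonoid.closure {Had, Sgate}, ∃! i, ∃ z : ℂ, u = z • c i)

/-- The Kraus operator `A₊` of the channel `N_(u,v)`. -/
noncomputable def Aplus (u v : ℝ) : Matrix (Fin 2) (Fin 2) ℂ :=
  !![((Real.cos ((v - u) / 2) : ℝ) : ℂ), 0; 0, ((Real.cos ((v + u) / 2) : ℝ) : ℂ)]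

/-- The Kraus operator `A₋` of the channel `N_(u,v)`. -/
noncomputable def Aminus (u v : ℝ) : Matrix (Fin 2) (Fin 2) ℂ :=
  !![0, ((Real.sin ((v + u) / 2) : ℝ) : ℂ); ((Real.sin ((v - u) / 2) : ℝ) : ℂ), 0]

/-- The two-parameter qubit channel `N_(u,v)` with Kraus operators `A₊`, `A₋`. -/
noncomputable def Nuv (u v : ℝ) : KrausFamily (Fin 2) (Fin 2) where
  ι := Fin 2
  K := ![Aplus u v, Aminus u v]

/-- The flagged channel `T^dep_(u,v)(ρ) = (1/|C|) Σ_{c ∈ C} c† N_(u,v)(c ρ c†) c ⊗ |c⟩⟨c|`,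
with Kraus operators `(1/√|C|) c† A_± c ⊗ |c⟩` for `c` running over a family of
representatives of the Clifford group. -/
noncomputable def Tdep (u v : ℝ) (c : Fin 24 → Matrix (Fin 2) (Fin 2) ℂ) :
    KrausFamily (Fin 2) (Fin 2 × Fin 24) where
  ι := Fin 24 × Fin 2
  K x := Matrix.of fun bf a =>
    if bf.2 = x.1 then
      ((Real.sqrt 24)⁻¹ : ℂ) * ((c x.1)ᴴ * (![Aplus u v, Aminus u v] x.2) * c x.1) bf.1 a
    else 0

/-- Binary entropy `H(x) = −x log₂ x − (1−x) log₂ (1−x)`. -/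
noncomputable def binEnt (x : ℝ) : ℝ :=
  -x * Real.logb 2 x - (1 - x) * Real.logb 2 (1 - x)

/-- The power series `∑ wᵏ / (2k+1)` of `artanh (√w) / √w`. -/
noncomputable def artanhSeries (w : ℝ) : ℝ := ∑' k : ℕ, w ^ k / (2 * k + 1)

/-- The power series `∑ 2 wᵏ / ((2k+1)(2k+3))`, the normalised remainder of `artanhSeries`. -/
noncomputable def artanhRemainder (w : ℝ) : ℝ := ∑' k : ℕ, 2 / ((2 * k + 1) * (2 * k + 3)) * w ^ k

/-- The qubit entropy deficit `ln 2 - H((1 + √w) / 2)` in nats, in a form smooth at `w = 0`. -/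
noncomputable def entropyDeficit (w : ℝ) : ℝ := Real.log (1 - w) / 2 + w * artanhSeries w

lemma hasSum_artanhSeries {w : ℝ} (hw : |w| < 1) :
    HasSum (fun k : ℕ => w ^ k / (2 * k + 1)) (artanhSeries w) := by
  refine Summable.hasSum (Summable.of_norm_bounded (summable_geometric_of_abs_lt_one
    (r := |w|) (by rwa [abs_abs])) fun k => ?_)
  rw [norm_div, norm_pow, Real.norm_eq_abs]
  refine div_le_self (by positivity) ?_
  rw [Real.norm_eq_abs]
  exact le_trans (by linarith [(Nat.cast_nonneg k : (0 : ℝ) ≤ k)]) (le_abs_self _)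

lemma sum_range_artanhRemainder_coeff_le (n : ℕ) :
    ∑ k ∈ Finset.range n, 2 / ((2 * (k : ℝ) + 1) * (2 * k + 3)) ≤ 1 := by
  have h : ∑ k ∈ Finset.range n, 2 / ((2 * (k : ℝ) + 1) * (2 * k + 3)) = 1 - 1 / (2 * n + 1) := by
    induction n with
    | zero => simp
    | succ n ih =>
      rw [Finset.sum_range_succ, ih]
      push_cast
      field_simp
      ring
  rw [h]
  have : (0 : ℝ) ≤ 1 / (2 * n + 1) := by positivity
  linarith

lemma summable_artanhRemainder_coeff :
    Summable fun k : ℕ => 2 / ((2 * (k : ℝ) + 1) * (2 * k + 3)) :=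
  summable_of_sum_range_le (fun _ => by positivity) sum_range_artanhRemainder_coeff_le

lemma hasSum_artanhRemainder {w : ℝ} (hw : |w| ≤ 1) :
    HasSum (fun k : ℕ => 2 / ((2 * (k : ℝ) + 1) * (2 * k + 3)) * w ^ k) (artanhRemainder w) := by
  refine Summable.hasSum (Summable.of_norm_bounded summable_artanhRemainder_coeff fun k => ?_)
  rw [norm_mul, norm_pow, Real.norm_of_nonneg (by positivity)]
  exact mul_le_of_le_one_right (by positivity) (pow_le_one₀ (norm_nonneg _) hw)

lemma artanhRemainder_nonneg {w : ℝ} (hw : 0 ≤ w) : 0 ≤ artanhRemainder w :=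
  tsum_nonneg fun k => by positivity

lemma artanhRemainder_le {w w' : ℝ} (hw : 0 ≤ w) (h : w ≤ w') (hw' : w' ≤ 1) :
    artanhRemainder w ≤ artanhRemainder w' := by
  refine hasSum_le (fun k => ?_) (hasSum_artanhRemainder (abs_le.2 ⟨by linarith, by linarith⟩))
    (hasSum_artanhRemainder (abs_le.2 ⟨by linarith, by linarith⟩))
  gcongr

lemma artanhRemainder_le_one {w : ℝ} (hw : 0 ≤ w) (hw' : w ≤ 1) : artanhRemainder w ≤ 1 := by
  refine (artanhRemainder_le hw hw' le_rfl).trans ?_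
  unfold artanhRemainder
  simp only [one_pow, mul_one]
  exact Real.tsum_le_of_sum_range_le (fun _ => by positivity) sum_range_artanhRemainder_coeff_le

lemma one_sub_mul_artanhSeries {w : ℝ} (hw : |w| < 1) :
    (1 - w) * artanhSeries w = 1 - w * artanhRemainder w := by
  have h := hasSum_artanhSeries hw
  have h1 := ((hasSum_nat_add_iff' 1).2 h)
  have h2 := (h.mul_left w).sub h1
  have h3 := (hasSum_artanhRemainder hw.le).mul_left w
  have h4 := h3.unique (h2.congr_fun ?_)
  · simp at h4
    linarith
  · intro k
    push_cast
    field_simp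
    ring

lemma one_le_artanhSeries {w : ℝ} (hw : 0 ≤ w) (hw' : w < 1) : 1 ≤ artanhSeries w := by
  have h := (hasSum_artanhSeries (abs_lt.2 ⟨by linarith, hw'⟩)).summable.le_tsum 0
    fun k _ => by positivity
  simpa [artanhSeries] using h

lemma one_sub_mul_artanhSeries_le {w w' : ℝ} (hw : 0 ≤ w) (h : w ≤ w') (hw' : w' < 1) :
    (1 - w') * artanhSeries w' ≤ (1 - w) * artanhSeries w := by
  rw [one_sub_mul_artanhSeries (abs_lt.2 ⟨by linarith, by linarith⟩),
    one_sub_mul_artanhSeries (abs_lt.2 ⟨by linarith, by linarith⟩)]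
  have := mul_le_mul h (artanhRemainder_le hw h hw'.le) (artanhRemainder_nonneg hw) (hw.trans h)
  linarith

lemma hasDerivAt_artanhSeries {w : ℝ} (hw : |w| < 1) :
    HasDerivAt artanhSeries (artanhRemainder w / (2 * (1 - w))) w := by
  obtain ⟨ρ, h1, h2⟩ := exists_between hw
  have hρ : 0 ≤ ρ := (abs_nonneg w).trans h1.le
  have hu : Summable fun k : ℕ => (k : ℝ) * ρ ^ (k - 1) := by
    refine (summable_nat_add_iff 1).1 ?_
    have a := summable_pow_mul_geometric_of_norm_lt_one 1 (r := ρ)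
      (by rwa [Real.norm_of_nonneg hρ])
    have b := summable_geometric_of_lt_one hρ h2
    refine (a.add b).congr fun k => ?_
    simp only [Nat.add_sub_cancel]
    push_cast
    ring
  have hbd : ∀ (k : ℕ) (y : ℝ), y ∈ Metric.ball (0 : ℝ) ρ →
      ‖(k : ℝ) * y ^ (k - 1) / (2 * k + 1)‖ ≤ (k : ℝ) * ρ ^ (k - 1) := by
    intro k y hy
    rw [mem_ball_zero_iff] at hy
    rw [norm_div, norm_mul, norm_pow, Real.norm_of_nonneg (Nat.cast_nonneg k),
      Real.norm_of_nonneg (by positivity : (0 : ℝ) ≤ 2 * k + 1)]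
    refine (div_le_self (by positivity) (by
      linarith [(Nat.cast_nonneg k : (0 : ℝ) ≤ k)])).trans ?_
    gcongr
  have hw' : w ∈ Metric.ball (0 : ℝ) ρ := by rwa [mem_ball_zero_iff]
  have hd : HasDerivAt artanhSeries (∑' k : ℕ, (k : ℝ) * w ^ (k - 1) / (2 * k + 1)) w :=
    hasDerivAt_tsum_of_isPreconnected hu Metric.isOpen_ball
      (convex_ball (0 : ℝ) ρ).isPreconnected
      (fun k y _ => (hasDerivAt_pow k y).div_const _) hbd hw' (hasSum_artanhSeries hw).summable hw'
  have hs := (Summable.of_norm_bounded hu fun k => hbd k w hw').hasSum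
  have h1w : 0 < 1 - w := by linarith [(abs_lt.1 hw).2]
  convert hd using 1
  rw [div_eq_iff (by positivity)]
  have hs' := (hasSum_nat_add_iff' 1).2 hs
  have h3 := (hs'.mul_left 2).sub (hs.mul_left (2 * w))
  have h4 := (hasSum_artanhRemainder hw.le).unique (h3.congr_fun ?_)
  · simp at h4
    linarith
  · intro k
    rcases k with _ | k
    · norm_num
    · push_cast
      field_simp
      ring

lemma hasDerivAt_entropyDeficit {w : ℝ} (hw : |w| < 1) :
    HasDerivAt entropyDeficit (artanhSeries w / 2) w := by
  have h1w : 0 < 1 - w := by linarith [(abs_lt.1 hw).2]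
  have h := ((((hasDerivAt_id' w).const_sub 1).log h1w.ne').div_const 2).add
    ((hasDerivAt_id' w).mul (hasDerivAt_artanhSeries hw))
  refine h.congr_deriv ?_
  have e := one_sub_mul_artanhSeries hw
  field_simp
  linarith

lemma entropyDeficit_eq {r : ℝ} (hr : |r| < 1) :
    entropyDeficit (r ^ 2) =
      ((1 + r) * Real.log (1 + r) + (1 - r) * Real.log (1 - r)) / 2 := by
  have h2 : |r ^ 2| < 1 := by rw [abs_pow]; exact pow_lt_one₀ (abs_nonneg _) hr two_ne_zero
  have h := (hasSum_artanhSeries h2).mul_left (2 * r)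
  have h' := (Real.hasSum_log_sub_log_of_abs_lt_one hr).unique (h.congr_fun fun k => by
    rw [← pow_mul]; ring)
  obtain ⟨ha, hb⟩ := abs_lt.1 hr
  have hl : Real.log (1 - r ^ 2) = Real.log (1 + r) + Real.log (1 - r) := by
    rw [← Real.log_mul (by linarith) (by linarith)]
    ring_nf
  unfold entropyDeficit
  rw [hl]
  linear_combination (-r / 2) * h'

/-- Squared Bloch norm of the output of `N_(u,v)` on the input with Bloch vector `(x, y, z)`,
where `X = x²` and `Y = y²`. -/
noncomputable def outNormSq (u v X Y z : ℝ) : ℝ :=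
  Real.cos u ^ 2 * X + Real.cos v ^ 2 * Y +
    (Real.cos u * Real.cos v * z + Real.sin u * Real.sin v) ^ 2

/-- Squared Bloch norm of the complementary output of `N_(u,v)` on the input with Bloch vector
`(x, y, z)`, where `X = x²` and `Y = y²`. -/
noncomputable def envNormSq (u v X Y z : ℝ) : ℝ :=
  Real.sin v ^ 2 * X + Real.sin u ^ 2 * Y +
    (Real.cos u * Real.cos v + Real.sin u * Real.sin v * z) ^ 2

lemma outNormSq_swap (u v X Y z : ℝ) : outNormSq u v X Y z = outNormSq v u Y X z := by
  unfold outNormSq; ring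

lemma envNormSq_swap (u v X Y z : ℝ) : envNormSq u v X Y z = envNormSq v u Y X z := by
  unfold envNormSq; ring

lemma outNormSq_nonneg {u v X Y z : ℝ} (hX : 0 ≤ X) (hY : 0 ≤ Y) : 0 ≤ outNormSq u v X Y z := by
  unfold outNormSq; positivity

lemma envNormSq_nonneg {u v X Y z : ℝ} (hX : 0 ≤ X) (hY : 0 ≤ Y) : 0 ≤ envNormSq u v X Y z := by
  unfold envNormSq; positivity

lemma outNormSq_eq (u v X Y z : ℝ) : outNormSq u v X Y z =
    envNormSq u v X Y z - (Real.cos u ^ 2 - Real.sin v ^ 2) * (1 - (X + Y + z ^ 2)) := by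
  unfold outNormSq envNormSq
  have h1 := Real.sin_sq_add_cos_sq u
  have h2 := Real.sin_sq_add_cos_sq v
  linear_combination (-Y - Real.sin v ^ 2 * (z ^ 2 - 1)) * h1 +
    (Y + Real.cos u ^ 2 * (z ^ 2 - 1)) * h2

lemma one_sub_envNormSq (u v X Y z : ℝ) : 1 - envNormSq u v X Y z =
    (Real.cos v * Real.sin u - Real.cos u * Real.sin v * z) ^ 2 +
      Real.sin v ^ 2 * (1 - (X + Y + z ^ 2)) + (Real.sin v ^ 2 - Real.sin u ^ 2) * Y := by
  unfold envNormSq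
  have h1 := Real.sin_sq_add_cos_sq u
  have h2 := Real.sin_sq_add_cos_sq v
  linear_combination -(Real.cos v ^ 2 + Real.sin v ^ 2 * z ^ 2) * h1 - h2

lemma envNormSq_lt_one {u v X Y z : ℝ} (hs : Real.sin u ≠ 0 ∨ Real.sin v ≠ 0) (hX : 0 ≤ X)
    (hY : 0 ≤ Y) (hr : X + Y + z ^ 2 < 1) : envNormSq u v X Y z < 1 := by
  wlog h : Real.sin u ^ 2 ≤ Real.sin v ^ 2 generalizing u v X Y
  · rw [envNormSq_swap]
    exact this hs.symm hY hX (by linarith) (le_of_not_ge h)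
  have hv : 0 < Real.sin v ^ 2 := by
    rcases hs with hs | hs
    · exact (pow_pos (abs_pos.2 hs) 2 |>.trans_eq (sq_abs _)).trans_le h
    · positivity
  have := one_sub_envNormSq u v X Y z
  have h1 := mul_pos hv (sub_pos.2 hr)
  have h2 := mul_nonneg (sub_nonneg.2 h) hY
  nlinarith [sq_nonneg (Real.cos v * Real.sin u - Real.cos u * Real.sin v * z)]

/-- Monotonicity of the right-logarithmic-derivative metric in the `z` direction. -/
lemma sin_mul_sin_sq_mul_one_sub_outNormSq_le {u v X Y z : ℝ}
    (hκ : Real.sin v ^ 2 ≤ Real.cos u ^ 2) (hX : 0 ≤ X) (hY : 0 ≤ Y) (hr : X + Y + z ^ 2 ≤ 1) :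
    (Real.sin u * Real.sin v) ^ 2 * (1 - outNormSq u v X Y z) ≤
      (Real.cos u * Real.cos v) ^ 2 * (1 - envNormSq u v X Y z) := by
  wlog h : Real.sin u ^ 2 ≤ Real.sin v ^ 2 generalizing u v X Y
  · rw [envNormSq_swap, outNormSq_swap, mul_comm (Real.sin u), mul_comm (Real.cos u)]
    refine this ?_ hY hX (by linarith) (le_of_not_ge h)
    linarith [Real.sin_sq_add_cos_sq u, Real.sin_sq_add_cos_sq v]
  have h1 := Real.sin_sq_add_cos_sq u
  have h2 := Real.sin_sq_add_cos_sq v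
  have hE := one_sub_envNormSq u v X Y z
  have key : (Real.cos u * Real.cos v) ^ 2 * (1 - envNormSq u v X Y z) -
      (Real.sin u * Real.sin v) ^ 2 * (1 - outNormSq u v X Y z) =
      (Real.cos u ^ 2 - Real.sin v ^ 2) * ((1 - envNormSq u v X Y z) -
        (Real.sin u * Real.sin v) ^ 2 * (1 - (X + Y + z ^ 2))) := by
    rw [outNormSq_eq]
    linear_combination (Real.sin v ^ 2 * (envNormSq u v X Y z - 1)) * h1 +
      (Real.cos u ^ 2 * (1 - envNormSq u v X Y z)) * h2
  have hs : (Real.cos u) ^ 2 * (Real.sin v ^ 2 * (1 - (X + Y + z ^ 2))) ≥ 0 :=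
    mul_nonneg (sq_nonneg _) (mul_nonneg (sq_nonneg _) (by linarith))
  have h3 := mul_nonneg (sub_nonneg.2 h) hY
  have h4 : 0 ≤ (1 - envNormSq u v X Y z) -
        (Real.sin u * Real.sin v) ^ 2 * (1 - (X + Y + z ^ 2)) := by
    have : (1 - envNormSq u v X Y z) - (Real.sin u * Real.sin v) ^ 2 * (1 - (X + Y + z ^ 2)) =
      (Real.cos v * Real.sin u - Real.cos u * Real.sin v * z) ^ 2 +
      (Real.cos u) ^ 2 * (Real.sin v ^ 2 * (1 - (X + Y + z ^ 2))) +
      (Real.sin v ^ 2 - Real.sin u ^ 2) * Y := by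
      rw [hE]
      linear_combination (-(Real.sin v ^ 2 * (1 - (X + Y + z ^ 2)))) * h1
    rw [this]
    positivity
  have h5 := mul_nonneg (sub_nonneg.2 hκ) h4
  linarith

/-- Monotonicity of the symmetric-logarithmic-derivative metric in the `z` direction. -/
lemma sin_mul_sin_sq_mul_one_sub_outNormSq_mul_le {u v X Y z : ℝ}
    (hκ : Real.sin v ^ 2 ≤ Real.cos u ^ 2) (hX : 0 ≤ X) (hY : 0 ≤ Y) (hr : X + Y + z ^ 2 ≤ 1) :
    (Real.sin u * Real.sin v) ^ 2 * (1 - outNormSq u v X Y z) *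
        (1 - (Real.sin v ^ 2 * X + Real.sin u ^ 2 * Y)) ≤
      (Real.cos u * Real.cos v) ^ 2 * (1 - envNormSq u v X Y z) *
        (1 - (Real.cos u ^ 2 * X + Real.cos v ^ 2 * Y)) := by
  wlog h : Real.sin u ^ 2 ≤ Real.sin v ^ 2 generalizing u v X Y
  · rw [envNormSq_swap, outNormSq_swap, mul_comm (Real.sin u), mul_comm (Real.cos u),
      add_comm (_ * X), add_comm (_ * X)]
    refine this ?_ hY hX (by linarith) (le_of_not_ge h)
    linarith [Real.sin_sq_add_cos_sq u, Real.sin_sq_add_cos_sq v]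
  have h1 := Real.sin_sq_add_cos_sq u
  have h2 := Real.sin_sq_add_cos_sq v
  have hE := one_sub_envNormSq u v X Y z
  have hR := outNormSq_eq u v X Y z
  generalize envNormSq u v X Y z = E at *
  generalize outNormSq u v X Y z = R at *
  generalize Real.sin u = s at *
  generalize Real.sin v = t at *
  generalize hW : X + Y = W at *
  have hX' : X = W - Y := by linarith
  have hW0 : 0 ≤ W := by linarith
  have hz := sq_nonneg z
  set δ := 1 - (W + z ^ 2) with hδ
  have hδ0 : 0 ≤ δ := by linarith
  have ha : Real.cos u ^ 2 = 1 - s ^ 2 := by linarith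
  have hb : Real.cos v ^ 2 = 1 - t ^ 2 := by linarith
  set Q := (Real.cos v * s - Real.cos u * t * z) ^ 2 with hQ
  have hQ0 : 0 ≤ Q := sq_nonneg _
  have hs1 : 0 ≤ 1 - s ^ 2 := ha ▸ sq_nonneg _
  have ht1 : 0 ≤ 1 - t ^ 2 := hb ▸ sq_nonneg _
  set y := (t ^ 2 - s ^ 2) * Y with hy
  have hy0 : 0 ≤ y := mul_nonneg (by linarith) hY
  have hw1 : 0 ≤ 1 - W := by linarith
  have hE' : E = 1 - Q - t ^ 2 * δ - y := by linarith
  have hκ0 : 0 ≤ 1 - s ^ 2 - t ^ 2 := by linarith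
  have key : (Real.cos u * Real.cos v) ^ 2 * (1 - E) * (1 - (Real.cos u ^ 2 * X + Real.cos v ^ 2 * Y))
      - (s * t) ^ 2 * (1 - R) * (1 - (t ^ 2 * X + s ^ 2 * Y)) =
      (1 - s ^ 2 - t ^ 2) * (Q * (1 - W + (1 - t ^ 2) * s ^ 2 * W) + t ^ 2 * δ * ((1 - W) * (1 - s ^ 2))
        + y * (Q + t ^ 2 * δ * (1 - s ^ 2) + (1 - W + (1 - t ^ 2) * s ^ 2 * W)) + y ^ 2) := by
    rw [mul_pow, hR, ha, hb, hE', hX', hy]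
    ring
  have : 0 ≤ (1 - s ^ 2 - t ^ 2) * (Q * (1 - W + (1 - t ^ 2) * s ^ 2 * W) + t ^ 2 * δ * ((1 - W) * (1 - s ^ 2))
        + y * (Q + t ^ 2 * δ * (1 - s ^ 2) + (1 - W + (1 - t ^ 2) * s ^ 2 * W)) + y ^ 2) := by
    positivity
  linarith

/-- The coherent information (up to normalisation) of `N_(u,v)` in Bloch coordinates. -/
noncomputable def deficitGap (u v X Y z : ℝ) : ℝ :=
  entropyDeficit (envNormSq u v X Y z) - entropyDeficit (outNormSq u v X Y z)

lemma hasDerivAt_entropyDeficit_sq {α m n z : ℝ} (h : |α + (m + n * z) ^ 2| < 1) :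
    HasDerivAt (fun z => entropyDeficit (α + (m + n * z) ^ 2))
      (n * (m + n * z) * artanhSeries (α + (m + n * z) ^ 2)) z := by
  have h1 : HasDerivAt (fun z => α + (m + n * z) ^ 2) (2 * (m + n * z) * n) z := by
    have := ((((hasDerivAt_id' z).const_mul n).const_add m).pow 2).const_add α
    refine this.congr_deriv ?_
    push_cast
    ring
  refine ((hasDerivAt_entropyDeficit h).comp z h1).congr_deriv ?_
  ring

lemma hasDerivAt_mul_artanhSeries_sq {α m n z : ℝ} (h : |α + (m + n * z) ^ 2| < 1) :
    HasDerivAt (fun z => n * (m + n * z) * artanhSeries (α + (m + n * z) ^ 2))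
      (n ^ 2 * (1 - α * artanhRemainder (α + (m + n * z) ^ 2)) / (1 - (α + (m + n * z) ^ 2))) z := by
  have h0 : HasDerivAt (fun z => m + n * z) n z := by
    simpa using ((hasDerivAt_id' z).const_mul n).const_add m
  have h1 : HasDerivAt (fun z => α + (m + n * z) ^ 2) (2 * (m + n * z) * n) z := by
    refine ((h0.pow 2).const_add α).congr_deriv ?_
    push_cast
    ring
  refine ((h0.const_mul n).mul ((hasDerivAt_artanhSeries h).comp z h1)).congr_deriv ?_
  have hp : 1 - (α + (m + n * z) ^ 2) ≠ 0 := by linarith [(abs_lt.1 h).2]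
  have e := one_sub_mul_artanhSeries h
  simp only [Function.comp]
  rw [eq_div_iff hp]
  obtain ⟨w, hw⟩ : ∃ w, w = α + (m + n * z) ^ 2 := ⟨_, rfl⟩
  rw [← hw] at e hp ⊢
  field_simp
  linear_combination n ^ 2 * e - n ^ 2 * artanhRemainder w * hw

lemma deficitGap_deriv2_nonpos {u v X Y z : ℝ} (hκ : Real.sin v ^ 2 ≤ Real.cos u ^ 2)
    (hs : Real.sin u ≠ 0 ∨ Real.sin v ≠ 0) (hX : 0 ≤ X) (hY : 0 ≤ Y) (hr : X + Y + z ^ 2 < 1) :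
    (Real.sin u * Real.sin v) ^ 2 * (1 - (Real.sin v ^ 2 * X + Real.sin u ^ 2 * Y) *
        artanhRemainder (envNormSq u v X Y z)) / (1 - envNormSq u v X Y z) -
      (Real.cos u * Real.cos v) ^ 2 * (1 - (Real.cos u ^ 2 * X + Real.cos v ^ 2 * Y) *
        artanhRemainder (outNormSq u v X Y z)) / (1 - outNormSq u v X Y z) ≤ 0 := by
  have hE := envNormSq_lt_one hs hX hY hr
  have hR0 := outNormSq_nonneg (u := u) (v := v) (z := z) hX hY
  have hRE : outNormSq u v X Y z ≤ envNormSq u v X Y z := by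
    have := mul_nonneg (sub_nonneg.2 hκ) (sub_nonneg.2 hr.le)
    linarith [outNormSq_eq u v X Y z]
  have i0 := sin_mul_sin_sq_mul_one_sub_outNormSq_le hκ hX hY hr.le
  have i1 := sin_mul_sin_sq_mul_one_sub_outNormSq_mul_le hκ hX hY hr.le
  have c0 := artanhRemainder_nonneg hR0
  have c1 := artanhRemainder_le_one hR0 (hRE.trans hE.le)
  have cm := artanhRemainder_le hR0 hRE hE.le
  have hα : 0 ≤ Real.sin v ^ 2 * X + Real.sin u ^ 2 * Y := by positivity
  rw [sub_nonpos, div_le_div_iff₀ (by linarith) (by linarith)]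
  have j0 := mul_le_mul_of_nonneg_left i0 (sub_nonneg.2 c1)
  have j1 := mul_le_mul_of_nonneg_left i1 c0
  have hR1 : 0 ≤ 1 - outNormSq u v X Y z := by linarith
  have j2 := mul_le_mul_of_nonneg_left (mul_le_mul_of_nonneg_left cm hα)
    (mul_nonneg (sq_nonneg (Real.sin u * Real.sin v)) hR1)
  linarith

lemma deficitGap_add_reflect_le {u v X Y z : ℝ} (hκ : Real.sin v ^ 2 ≤ Real.cos u ^ 2)
    (hs : Real.sin u ≠ 0 ∨ Real.sin v ≠ 0) (hX : 0 ≤ X) (hY : 0 ≤ Y) (hr : X + Y + z ^ 2 < 1) :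
    deficitGap u v X Y z + deficitGap u v X Y (-z) ≤ 2 * deficitGap u v X Y 0 := by
  have hbd : ∀ x ∈ Set.Icc (-|z|) |z|, X + Y + x ^ 2 < 1 := fun x hx => by
    have := sq_le_sq' hx.1 hx.2
    rw [sq_abs] at this
    linarith
  have hE : ∀ x ∈ Set.Icc (-|z|) |z|, |Real.sin v ^ 2 * X + Real.sin u ^ 2 * Y +
      (Real.cos u * Real.cos v + Real.sin u * Real.sin v * x) ^ 2| < 1 := fun x hx =>
    abs_lt.2 ⟨neg_one_lt_zero.trans_le (envNormSq_nonneg (u := u) (v := v) (z := x) hX hY),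
      envNormSq_lt_one hs hX hY (hbd x hx)⟩
  have hR : ∀ x ∈ Set.Icc (-|z|) |z|, |Real.cos u ^ 2 * X + Real.cos v ^ 2 * Y +
      (Real.sin u * Real.sin v + Real.cos u * Real.cos v * x) ^ 2| < 1 := fun x hx => by
    have e : Real.cos u ^ 2 * X + Real.cos v ^ 2 * Y +
      (Real.sin u * Real.sin v + Real.cos u * Real.cos v * x) ^ 2 = outNormSq u v X Y x := by
      rw [outNormSq, add_comm (Real.sin u * _)]
    have := mul_nonneg (sub_nonneg.2 hκ) (sub_nonneg.2 (hbd x hx).le)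
    have h1 := envNormSq_lt_one hs hX hY (hbd x hx)
    rw [e]
    exact abs_lt.2 ⟨by linarith [outNormSq_nonneg (u := u) (v := v) (z := x) hX hY],
      by linarith [outNormSq_eq u v X Y x]⟩
  have hfun : ∀ x, deficitGap u v X Y x = entropyDeficit (Real.sin v ^ 2 * X + Real.sin u ^ 2 * Y +
      (Real.cos u * Real.cos v + Real.sin u * Real.sin v * x) ^ 2) -
      entropyDeficit (Real.cos u ^ 2 * X + Real.cos v ^ 2 * Y +
      (Real.sin u * Real.sin v + Real.cos u * Real.cos v * x) ^ 2) := fun x => by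
    rw [deficitGap, envNormSq, outNormSq, add_comm (Real.sin u * _) (_ * x)]
  have hconc : ConcaveOn ℝ (Set.Icc (-|z|) |z|) (deficitGap u v X Y) := by
    rw [funext hfun]
    refine concaveOn_of_hasDerivWithinAt2_nonpos (convex_Icc _ _) (fun x hx =>
      ((hasDerivAt_entropyDeficit_sq (hE x hx)).sub
        (hasDerivAt_entropyDeficit_sq (hR x hx))).continuousAt.continuousWithinAt)
      (fun x hx => ((hasDerivAt_entropyDeficit_sq (hE x (interior_subset hx))).sub
        (hasDerivAt_entropyDeficit_sq (hR x (interior_subset hx)))).hasDerivWithinAt)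
      (fun x hx => ((hasDerivAt_mul_artanhSeries_sq (hE x (interior_subset hx))).sub
        (hasDerivAt_mul_artanhSeries_sq (hR x (interior_subset hx)))).hasDerivWithinAt)
      (fun x hx => ?_)
    have := deficitGap_deriv2_nonpos hκ hs hX hY (hbd x (interior_subset hx))
    rw [envNormSq, outNormSq, add_comm (_ * x) (Real.sin u * _)] at this
    exact this
  have hz : z ∈ Set.Icc (-|z|) |z| := ⟨neg_abs_le z, le_abs_self z⟩
  have hz' : -z ∈ Set.Icc (-|z|) |z| := ⟨neg_le_neg (le_abs_self z), neg_le_abs z⟩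
  have := hconc.2 hz hz' (by norm_num : (0 : ℝ) ≤ 1 / 2) (by norm_num : (0 : ℝ) ≤ 1 / 2) (by norm_num)
  simp only [smul_eq_mul] at this
  rw [show 1 / 2 * z + 1 / 2 * -z = 0 by ring] at this
  linarith

/-- Comparison of the slopes of `deficitGap` in the equatorial direction `X`. -/
lemma sin_sq_mul_artanhSeries_le {u v X Y : ℝ} (hκ : Real.sin v ^ 2 ≤ Real.cos u ^ 2)
    (hs : Real.sin u ≠ 0 ∨ Real.sin v ≠ 0) (hX : 0 ≤ X) (hY : 0 ≤ Y) (hr : X + Y < 1) :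
    Real.sin v ^ 2 * artanhSeries (envNormSq u v X Y 0) ≤
      Real.cos u ^ 2 * artanhSeries (outNormSq u v X Y 0) := by
  have hr' : X + Y + (0 : ℝ) ^ 2 < 1 := by linarith
  have hE := envNormSq_lt_one hs hX hY hr'
  have hR0 := outNormSq_nonneg (u := u) (v := v) (z := 0) hX hY
  have hRE : outNormSq u v X Y 0 ≤ envNormSq u v X Y 0 := by
    have := mul_nonneg (sub_nonneg.2 hκ) (sub_nonneg.2 hr'.le)
    linarith [outNormSq_eq u v X Y 0]
  have hL := one_sub_mul_artanhSeries_le hR0 hRE hE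
  have hLpos := one_le_artanhSeries hR0 (hRE.trans_lt hE)
  have key : Real.sin v ^ 2 * (1 - outNormSq u v X Y 0) ≤
      Real.cos u ^ 2 * (1 - envNormSq u v X Y 0) := by
    have h1 := Real.sin_sq_add_cos_sq u
    have h2 := Real.sin_sq_add_cos_sq v
    have ha : Real.cos u ^ 2 = 1 - Real.sin u ^ 2 := by linarith
    have hb : Real.cos v ^ 2 = 1 - Real.sin v ^ 2 := by linarith
    have e : Real.cos u ^ 2 * (1 - envNormSq u v X Y 0) -
        Real.sin v ^ 2 * (1 - outNormSq u v X Y 0) =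
        (Real.cos u ^ 2 - Real.sin v ^ 2) *
          (Real.cos v ^ 2 * Real.sin u ^ 2 * (1 - Y) + Real.cos u ^ 2 * Real.sin v ^ 2 * Y) := by
      unfold envNormSq outNormSq
      simp only [mul_zero, add_zero, zero_add, mul_pow, ha, hb]
      ring
    have : 0 ≤ (Real.cos u ^ 2 - Real.sin v ^ 2) *
          (Real.cos v ^ 2 * Real.sin u ^ 2 * (1 - Y) + Real.cos u ^ 2 * Real.sin v ^ 2 * Y) :=
      mul_nonneg (by linarith) (add_nonneg (mul_nonneg (by positivity) (by linarith))
        (by positivity))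
    linarith
  have hE1 : 0 < 1 - envNormSq u v X Y 0 := by linarith
  refine le_of_mul_le_mul_right ?_ hE1
  have k1 := mul_le_mul_of_nonneg_left hL (sq_nonneg (Real.sin v))
  have k2 := mul_le_mul_of_nonneg_right key (zero_le_one.trans hLpos)
  linarith

lemma deficitGap_equator_le {u v X Y : ℝ} (hκ : Real.sin v ^ 2 ≤ Real.cos u ^ 2)
    (hs : Real.sin u ≠ 0 ∨ Real.sin v ≠ 0) (hX : 0 ≤ X) (hY : 0 ≤ Y) (hr : X + Y < 1) :
    deficitGap u v X Y 0 ≤ deficitGap u v 0 0 0 := by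
  have hlt : ∀ t ∈ Set.Icc (0 : ℝ) 1, t * X + t * Y < 1 := fun t ht => by
    have := mul_le_mul_of_nonneg_right ht.2 (add_nonneg hX hY)
    linarith
  have hE : ∀ t ∈ Set.Icc (0 : ℝ) 1, |envNormSq u v (t * X) (t * Y) 0| < 1 := fun t ht => by
    have hX' := mul_nonneg ht.1 hX
    have hY' := mul_nonneg ht.1 hY
    have h0 := envNormSq_nonneg (u := u) (v := v) (z := 0) hX' hY'
    exact abs_lt.2 ⟨by linarith, envNormSq_lt_one hs hX' hY' (by linarith [hlt t ht])⟩
  have hR : ∀ t ∈ Set.Icc (0 : ℝ) 1, |outNormSq u v (t * X) (t * Y) 0| < 1 := fun t ht => by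
    have hX' := mul_nonneg ht.1 hX
    have hY' := mul_nonneg ht.1 hY
    have h0 := outNormSq_nonneg (u := u) (v := v) (z := 0) hX' hY'
    have h1 := mul_nonneg (sub_nonneg.2 hκ) (sub_nonneg.2 (hlt t ht).le)
    have h2 := (abs_lt.1 (hE t ht)).2
    have h3 := outNormSq_eq u v (t * X) (t * Y) 0
    exact abs_lt.2 ⟨by linarith, by linarith⟩
  have dE : ∀ t, HasDerivAt (fun t => envNormSq u v (t * X) (t * Y) 0)
      (Real.sin v ^ 2 * X + Real.sin u ^ 2 * Y) t := fun t => by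
    have := ((((hasDerivAt_id' t).mul_const X).const_mul (Real.sin v ^ 2)).add
      (((hasDerivAt_id' t).mul_const Y).const_mul (Real.sin u ^ 2))).add_const
      ((Real.cos u * Real.cos v + Real.sin u * Real.sin v * 0) ^ 2)
    exact this.congr_deriv (by ring)
  have dR : ∀ t, HasDerivAt (fun t => outNormSq u v (t * X) (t * Y) 0)
      (Real.cos u ^ 2 * X + Real.cos v ^ 2 * Y) t := fun t => by
    have := ((((hasDerivAt_id' t).mul_const X).const_mul (Real.cos u ^ 2)).add
      (((hasDerivAt_id' t).mul_const Y).const_mul (Real.cos v ^ 2))).add_const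
      ((Real.cos u * Real.cos v * 0 + Real.sin u * Real.sin v) ^ 2)
    exact this.congr_deriv (by ring)
  have hd : ∀ t ∈ Set.Icc (0 : ℝ) 1, HasDerivAt (fun t => deficitGap u v (t * X) (t * Y) 0)
      (artanhSeries (envNormSq u v (t * X) (t * Y) 0) / 2 *
          (Real.sin v ^ 2 * X + Real.sin u ^ 2 * Y) -
        artanhSeries (outNormSq u v (t * X) (t * Y) 0) / 2 *
          (Real.cos u ^ 2 * X + Real.cos v ^ 2 * Y)) t := fun t ht => by
    have h1 := (hasDerivAt_entropyDeficit (hE t ht)).comp t (dE t)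
    have h2 := (hasDerivAt_entropyDeficit (hR t ht)).comp t (dR t)
    exact h1.sub h2
  have hanti := antitoneOn_of_hasDerivWithinAt_nonpos (convex_Icc (0 : ℝ) 1)
    (fun t ht => (hd t ht).continuousAt.continuousWithinAt)
    (fun t ht => (hd t (interior_subset ht)).hasDerivWithinAt) fun t ht => by
      have ht := interior_subset ht
      have hX' := mul_nonneg ht.1 hX
      have hY' := mul_nonneg ht.1 hY
      have a := sin_sq_mul_artanhSeries_le hκ hs hX' hY' (hlt t ht)
      have b := sin_sq_mul_artanhSeries_le (u := v) (v := u)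
        (by linarith [Real.sin_sq_add_cos_sq u, Real.sin_sq_add_cos_sq v]) hs.symm hY' hX'
        (by linarith [hlt t ht])
      rw [envNormSq_swap, outNormSq_swap] at b
      have a' := mul_le_mul_of_nonneg_right a hX
      have b' := mul_le_mul_of_nonneg_right b hY
      linarith
  have := hanti (Set.left_mem_Icc.2 zero_le_one) (Set.right_mem_Icc.2 zero_le_one) zero_le_one
  simpa using this

/-- The entropy deficit `ln 2 - H((1 + √w) / 2)` in nats of a qubit state with squared Bloch
norm `w`. -/
noncomputable def qubitDeficit (w : ℝ) : ℝ :=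
  ((1 + √w) * Real.log (1 + √w) + (1 - √w) * Real.log (1 - √w)) / 2

lemma qubitDeficit_eq_entropyDeficit {w : ℝ} (h0 : 0 ≤ w) (h1 : w < 1) :
    qubitDeficit w = entropyDeficit w := by
  have h : |√w| < 1 := by
    rw [abs_of_nonneg (Real.sqrt_nonneg w), Real.sqrt_lt' one_pos]
    simpa
  rw [qubitDeficit, ← entropyDeficit_eq h, Real.sq_sqrt h0]

lemma sub_one_le_mul_log {x : ℝ} (hx : 0 ≤ x) : x - 1 ≤ x * Real.log x := by
  rcases hx.eq_or_lt with rfl | h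
  · simp
  · have := mul_le_mul_of_nonneg_left (Real.one_sub_inv_le_log_of_pos h) hx
    rwa [mul_sub, mul_inv_cancel₀ h.ne', mul_one] at this

lemma qubitDeficit_nonneg {w : ℝ} (h1 : w ≤ 1) : 0 ≤ qubitDeficit w := by
  have hs : √w ≤ 1 := Real.sqrt_le_one.2 h1
  have a := sub_one_le_mul_log (x := 1 + √w) (by positivity)
  have b := sub_one_le_mul_log (x := 1 - √w) (by linarith)
  unfold qubitDeficit
  linarith

lemma entropyDeficit_monotoneOn : MonotoneOn entropyDeficit (Set.Ico 0 1) := by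
  have hd : ∀ w ∈ Set.Ico (0 : ℝ) 1, HasDerivAt entropyDeficit (artanhSeries w / 2) w :=
    fun w hw => hasDerivAt_entropyDeficit (abs_lt.2 ⟨by linarith [hw.1], hw.2⟩)
  refine monotoneOn_of_hasDerivWithinAt_nonneg (convex_Ico 0 1)
    (fun w hw => (hd w hw).continuousAt.continuousWithinAt)
    (fun w hw => (hd w (interior_subset hw)).hasDerivWithinAt) fun w hw => ?_
  have hw := interior_subset hw
  linarith [one_le_artanhSeries hw.1 hw.2]

/-- `deficitGap` averaged over a reflection in `z` is maximal at the centre of the Bloch ball. -/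
lemma qubitDeficit_gap_add_reflect_le {u v X Y z : ℝ} (huv : |Real.sin v| ≤ |Real.cos u|)
    (hX : 0 ≤ X) (hY : 0 ≤ Y) (hr : X + Y + z ^ 2 ≤ 1) :
    (qubitDeficit (envNormSq u v X Y z) - qubitDeficit (outNormSq u v X Y z)) +
      (qubitDeficit (envNormSq u v X Y (-z)) - qubitDeficit (outNormSq u v X Y (-z))) ≤
    2 * (qubitDeficit (envNormSq u v 0 0 0) - qubitDeficit (outNormSq u v 0 0 0)) := by
  have hκ : Real.sin v ^ 2 ≤ Real.cos u ^ 2 := sq_le_sq.2 huv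
  have hle : ∀ {X Y z : ℝ}, X + Y + z ^ 2 ≤ 1 → outNormSq u v X Y z ≤ envNormSq u v X Y z :=
    fun {X Y z} h => by
      linarith [outNormSq_eq u v X Y z, mul_nonneg (sub_nonneg.2 hκ) (sub_nonneg.2 h)]
  have hr' : X + Y + (-z) ^ 2 ≤ 1 := by rwa [neg_sq]
  by_cases hs : Real.sin u ≠ 0 ∨ Real.sin v ≠ 0
  · have hgap : ∀ {X Y z : ℝ}, 0 ≤ X → 0 ≤ Y → X + Y + z ^ 2 < 1 →
        qubitDeficit (envNormSq u v X Y z) - qubitDeficit (outNormSq u v X Y z) =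
          deficitGap u v X Y z := fun {X Y z} hX hY h => by
      have hE := envNormSq_lt_one hs hX hY h
      rw [qubitDeficit_eq_entropyDeficit (envNormSq_nonneg hX hY) hE,
        qubitDeficit_eq_entropyDeficit (outNormSq_nonneg hX hY) ((hle h.le).trans_lt hE),
        deficitGap]
    have h00 : (0 : ℝ) + 0 + 0 ^ 2 < 1 := by norm_num
    rw [hgap le_rfl le_rfl h00]
    rcases hr.lt_or_eq with h | h
    · rw [hgap hX hY h, hgap hX hY (by rwa [neg_sq])]
      have h1 := deficitGap_add_reflect_le hκ hs hX hY h
      have h2 := deficitGap_equator_le hκ hs hX hY (by linarith [sq_nonneg z])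
      linarith
    · have e1 : outNormSq u v X Y z = envNormSq u v X Y z := by
        rw [outNormSq_eq, h]; ring
      have e2 : outNormSq u v X Y (-z) = envNormSq u v X Y (-z) := by
        rw [outNormSq_eq, neg_sq, h]; ring
      have hE := envNormSq_lt_one hs le_rfl le_rfl h00
      have := entropyDeficit_monotoneOn ⟨outNormSq_nonneg le_rfl le_rfl, (hle h00.le).trans_lt hE⟩
        ⟨envNormSq_nonneg le_rfl le_rfl, hE⟩ (hle h00.le)
      rw [e1, e2, deficitGap]
      linarith
  · push Not at hs
    have hu : Real.cos u ^ 2 = 1 := by simpa [hs.1] using Real.sin_sq_add_cos_sq u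
    have hv : Real.cos v ^ 2 = 1 := by simpa [hs.2] using Real.sin_sq_add_cos_sq v
    have hE : ∀ X Y z : ℝ, envNormSq u v X Y z = 1 := fun X Y z => by
      simp [envNormSq, hs.1, hs.2, mul_pow, hu, hv]
    have h0 : qubitDeficit (outNormSq u v 0 0 0) = 0 := by
      simp [outNormSq, hs.1, hs.2, qubitDeficit]
    have h1 := qubitDeficit_nonneg ((hle hr).trans (hE _ _ _).le)
    have h2 := qubitDeficit_nonneg ((hle hr').trans (hE _ _ _).le)
    rw [hE, hE, hE, h0]
    linarith

lemma vnEntropy_eq_sum_roots {n : Type} [Fintype n] [DecidableEq n] {ρ : Matrix n n ℂ}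
    (h : ρ.IsHermitian) :
    vnEntropy ρ = (ρ.charpoly.roots.map fun z => -(z.re * Real.logb 2 z.re)).sum := by
  rw [vnEntropy, dif_pos h, h.roots_charpoly_eq_eigenvalues, Multiset.map_map,
    ← Finset.sum_neg_distrib]
  simp [Function.comp_def]

lemma neg_mul_logb_half_mul {p x : ℝ} (hp : 0 < p) :
    -(p / 2 * x * Real.logb 2 (p / 2 * x)) =
      p / Real.log 2 * (-(x * Real.log (p / 2)) - x * Real.log x) / 2 := by
  rcases eq_or_ne x 0 with rfl | hx
  · simp
  · rw [Real.logb, Real.log_mul (by positivity) hx]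
    ring

open Polynomial in
lemma vnEntropy_eq_of_charpoly_eq_prod {n ι : Type} [Fintype n] [DecidableEq n] [Fintype ι]
    {ρ : Matrix n n ℂ} (h : ρ.IsHermitian) {p : ℝ} (hp : 0 < p) {w : ι → ℝ} (hw : ∀ i, 0 ≤ w i)
    (hρ : ρ.charpoly = ∏ i, (X ^ 2 - C (p : ℂ) * X + C ((p ^ 2 * (1 - w i) / 4 : ℝ) : ℂ))) :
    vnEntropy ρ = ∑ i, p / Real.log 2 * (-Real.log (p / 2) - qubitDeficit (w i)) := by
  have hf : ∀ i, (X ^ 2 - C (p : ℂ) * X + C ((p ^ 2 * (1 - w i) / 4 : ℝ) : ℂ)) =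
      (X - C ((p / 2 * (1 + √(w i)) : ℝ) : ℂ)) * (X - C ((p / 2 * (1 - √(w i)) : ℝ) : ℂ)) := by
    intro i
    have e1 : (p : ℂ) = ((p / 2 * (1 + √(w i)) : ℝ) : ℂ) + ((p / 2 * (1 - √(w i)) : ℝ) : ℂ) := by
      push_cast; ring
    have e2 : ((p ^ 2 * (1 - w i) / 4 : ℝ) : ℂ) =
        ((p / 2 * (1 + √(w i)) : ℝ) : ℂ) * ((p / 2 * (1 - √(w i)) : ℝ) : ℂ) := by
      rw [← Complex.ofReal_mul]
      congr 1
      linear_combination (-p ^ 2 / 4) * (- Real.sq_sqrt (hw i))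
    rw [e2, C_mul]
    conv_lhs => rw [e1]
    rw [C_add]
    ring
  rw [vnEntropy_eq_sum_roots h, hρ, Finset.prod_congr rfl fun i _ => hf i,
    roots_prod _ _ (Finset.prod_ne_zero_iff.2 fun i _ =>
      mul_ne_zero (X_sub_C_ne_zero _) (X_sub_C_ne_zero _)),
    Multiset.map_bind, Multiset.sum_bind]
  refine congrArg Multiset.sum (Multiset.map_congr rfl fun i _ => ?_)
  rw [roots_mul (mul_ne_zero (X_sub_C_ne_zero _) (X_sub_C_ne_zero _)), roots_X_sub_C,
    roots_X_sub_C]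
  simp only [Multiset.map_add, Multiset.map_singleton, Multiset.sum_add, Multiset.sum_singleton,
    Complex.ofReal_re]
  rw [neg_mul_logb_half_mul hp, neg_mul_logb_half_mul hp, qubitDeficit]
  ring

lemma charpoly_blockDiagonal {n ι R : Type*} [Fintype n] [DecidableEq n] [Fintype ι]
    [DecidableEq ι] [CommRing R] (M : ι → Matrix n n R) :
    (Matrix.blockDiagonal M).charpoly = ∏ k, (M k).charpoly := by
  have : (Matrix.blockDiagonal M).charmatrix = Matrix.blockDiagonal fun k => (M k).charmatrix := by
    ext ⟨i, k⟩ ⟨j, l⟩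
    simp only [Matrix.charmatrix_apply, Matrix.blockDiagonal_apply, Matrix.diagonal_apply,
      Prod.mk.injEq]
    by_cases hkl : k = l <;> by_cases hij : i = j <;> simp [hkl, hij]
  rw [Matrix.charpoly, this, Matrix.det_blockDiagonal]
  rfl

/-- The qubit operator with unit trace and Bloch vector `(x, y, z)`. -/
noncomputable def blochMatrix (x y z : ℝ) : Matrix (Fin 2) (Fin 2) ℂ :=
  !![(1 + z) / 2, (x - y * Complex.I) / 2; (x + y * Complex.I) / 2, (1 - z) / 2]

lemma IsDensity.exists_blochMatrix {ρ : Matrix (Fin 2) (Fin 2) ℂ} (h : IsDensity ρ) :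
    ∃ x y z : ℝ, ρ = blochMatrix x y z ∧ x ^ 2 + y ^ 2 + z ^ 2 ≤ 1 := by
  obtain ⟨hp, ht⟩ := h
  have hh := hp.isHermitian
  have h00 := hh.apply 0 0
  have h11 := hh.apply 1 1
  have h01 := hh.apply 1 0
  have hd := hp.det_nonneg
  rw [Matrix.trace_fin_two] at ht
  rw [Matrix.det_fin_two] at hd
  simp only [Complex.ext_iff, Complex.star_def, Complex.conj_re, Complex.conj_im, Complex.add_re,
    Complex.add_im, Complex.one_re, Complex.one_im] at h00 h11 h01 ht
  have hd := (Complex.le_def.1 hd).1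
  simp only [Complex.zero_re, Complex.sub_re, Complex.mul_re] at hd
  refine ⟨2 * (ρ 0 1).re, -2 * (ρ 0 1).im, (ρ 0 0).re - (ρ 1 1).re, ?_, ?_⟩
  · ext i j
    fin_cases i <;> fin_cases j <;>
      simp [blochMatrix, Complex.ext_iff] <;> constructor <;> linarith
  · have e : (ρ 0 0).re = 1 - (ρ 1 1).re := by linarith
    have i0 : (ρ 0 0).im = 0 := by linarith
    rw [← h01.1, ← h01.2, i0, e] at hd
    rw [e]
    nlinarith

lemma IsDensity.conj {ρ V : Matrix (Fin 2) (Fin 2) ℂ} (h : IsDensity ρ)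
    (hV : V ∈ Matrix.unitaryGroup (Fin 2) ℂ) : IsDensity (V * ρ * Vᴴ) := by
  refine ⟨h.1.mul_mul_conjTranspose_same V, ?_⟩
  rw [Matrix.trace_mul_comm, ← mul_assoc, ← Matrix.star_eq_conjTranspose,
    Matrix.mem_unitaryGroup_iff'.1 hV, one_mul, h.2]

open Polynomial in
/-- Characteristic polynomial of a multiple of the output of `N_(u,v)`, in half-angle form. -/
lemma charpoly_smul_output {a b s t : ℝ} (h1 : a ^ 2 + t ^ 2 = 1) (h2 : b ^ 2 + s ^ 2 = 1)
    (p x y z : ℝ) :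
    ((p : ℂ) • !![(a ^ 2 * (1 + z) / 2 + s ^ 2 * (1 - z) / 2 : ℂ),
        a * b * ((x - y * Complex.I) / 2) + s * t * ((x + y * Complex.I) / 2);
        a * b * ((x + y * Complex.I) / 2) + s * t * ((x - y * Complex.I) / 2),
        b ^ 2 * (1 - z) / 2 + t ^ 2 * (1 + z) / 2]).charpoly =
      X ^ 2 - C (p : ℂ) * X + C ((p ^ 2 * (1 - ((a * b + s * t) ^ 2 * x ^ 2 +
        (a * b - s * t) ^ 2 * y ^ 2 + ((a * b + s * t) * (a * b - s * t) * z +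
          (s * a - b * t) * (s * a + b * t)) ^ 2)) / 4 : ℝ) : ℂ) := by
  have g1 : (a : ℂ) ^ 2 + t ^ 2 = 1 := by exact_mod_cast h1
  have g2 : (b : ℂ) ^ 2 + s ^ 2 = 1 := by exact_mod_cast h2
  rw [Matrix.charpoly_fin_two, Matrix.trace_smul, Matrix.trace_fin_two_of, Matrix.det_smul,
    Matrix.det_fin_two_of, Fintype.card_fin]
  obtain ⟨P, hP⟩ : ∃ P : ℂ, P = (a ^ 2 * (1 + z) / 2 + s ^ 2 * (1 - z) / 2) +
    (b ^ 2 * (1 - z) / 2 + t ^ 2 * (1 + z) / 2) := ⟨_, rfl⟩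
  obtain ⟨M, hM⟩ : ∃ M : ℂ, M = (a ^ 2 * (1 + z) / 2 + s ^ 2 * (1 - z) / 2) -
    (b ^ 2 * (1 - z) / 2 + t ^ 2 * (1 + z) / 2) := ⟨_, rfl⟩
  obtain ⟨T, hT⟩ : ∃ T : ℂ, T = (a * b + s * t) * (a * b - s * t) * z +
        (s * a - b * t) * (s * a + b * t) := ⟨_, rfl⟩
  have hP1 : P = 1 := by
    linear_combination hP + ((1 + z) / 2 : ℂ) * g1 + ((1 - z) / 2 : ℂ) * g2
  have hMT : M = T := by
    linear_combination hM - hT + ((1 - z) * (b ^ 2 - s ^ 2) / 2 : ℂ) * g1 +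
      ((1 + z) * (t ^ 2 - a ^ 2) / 2 : ℂ) * g2
  have h4 : 4 * ((a ^ 2 * (1 + z) / 2 + s ^ 2 * (1 - z) / 2) *
      (b ^ 2 * (1 - z) / 2 + t ^ 2 * (1 + z) / 2)) = (1 - T ^ 2 : ℂ) := by
    have h : (4 * ((a ^ 2 * (1 + z) / 2 + s ^ 2 * (1 - z) / 2) *
        (b ^ 2 * (1 - z) / 2 + t ^ 2 * (1 + z) / 2)) : ℂ) = P ^ 2 - M ^ 2 := by
      rw [hP, hM]
      ring
    rw [h, hP1, hMT, one_pow]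
  rw [← hP, hP1, smul_eq_mul, mul_one]
  refine congrArg (fun d => X ^ 2 - C (p : ℂ) * X + C d) ?_
  simp only [Complex.ofReal_div, Complex.ofReal_mul, Complex.ofReal_sub, Complex.ofReal_add,
    Complex.ofReal_pow, Complex.ofReal_one, Complex.ofReal_ofNat]
  rw [← hT]
  linear_combination (p ^ 2 / 4 : ℂ) * h4 +
    (p ^ 2 / 4 * (a ^ 2 * b ^ 2 + s ^ 2 * t ^ 2 - 2 * a * b * s * t) * y ^ 2 : ℂ) * Complex.I_sq

/-- The twirled Kraus operators `c† A_± c` making up the flagged channel `Tdep`. -/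
noncomputable def twirledKraus (u v : ℝ) (c : Fin 24 → Matrix (Fin 2) (Fin 2) ℂ)
    (k : Fin 24) (s : Fin 2) : Matrix (Fin 2) (Fin 2) ℂ :=
  (c k)ᴴ * (![Aplus u v, Aminus u v] s) * c k

lemma flagged_mul_mul_conjTranspose_apply {ι : Type} [DecidableEq ι] (r : ℂ)
    (B B' φ : Matrix (Fin 2) (Fin 2) ℂ) (k k' : ι) (f f' : Fin 2 × ι) :
    (Matrix.of (fun (bf : Fin 2 × ι) a => if bf.2 = k then r * B bf.1 a else 0) * φ *
      (Matrix.of fun (bf : Fin 2 × ι) a => if bf.2 = k' then r * B' bf.1 a else 0)ᴴ) f f' =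
    if f.2 = k ∧ f'.2 = k' then r * star r * (B * φ * B'ᴴ) f.1 f'.1 else 0 := by
  by_cases h : f.2 = k <;> by_cases h' : f'.2 = k' <;>
    simp [Matrix.mul_apply, h, h', Fin.sum_univ_two]
  ring

lemma inv_sqrt_mul_star : ((Real.sqrt 24)⁻¹ : ℂ) * star ((Real.sqrt 24)⁻¹ : ℂ) =
    ((24⁻¹ : ℝ) : ℂ) := by
  rw [← Complex.ofReal_inv, Complex.star_def, Complex.conj_ofReal, ← Complex.ofReal_mul,
    ← mul_inv, Real.mul_self_sqrt (by norm_num)]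

lemma Tdep_apply_eq (u v : ℝ) (c : Fin 24 → Matrix (Fin 2) (Fin 2) ℂ)
    (φ : Matrix (Fin 2) (Fin 2) ℂ) :
    (Tdep u v c).apply φ = Matrix.blockDiagonal fun k =>
      ((24⁻¹ : ℝ) : ℂ) • ∑ s, twirledKraus u v c k s * φ * (twirledKraus u v c k s)ᴴ := by
  ext f f'
  change (∑ x : Fin 24 × Fin 2, (Tdep u v c).K x * φ * ((Tdep u v c).K x)ᴴ) f f' = _
  rw [Matrix.sum_apply, Fintype.sum_prod_type]
  have h : ∀ (k : Fin 24) (s : Fin 2), ((Tdep u v c).K (k, s) * φ * ((Tdep u v c).K (k, s))ᴴ) f f' =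
      if f.2 = k ∧ f'.2 = k then ((24⁻¹ : ℝ) : ℂ) *
        (twirledKraus u v c k s * φ * (twirledKraus u v c k s)ᴴ) f.1 f'.1 else 0 := fun k s => by
    rw [← inv_sqrt_mul_star]
    exact flagged_mul_mul_conjTranspose_apply _ _ _ _ _ _ _ _
  simp only [h, Matrix.blockDiagonal_apply, Matrix.smul_apply, Matrix.sum_apply, smul_eq_mul,
    Finset.mul_sum]
  rw [Finset.sum_eq_single f.2]
  · by_cases hf : f.2 = f'.2 <;> simp [hf, eq_comm]
  · intro k _ hk
    simp [hk.symm]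
  · simp

lemma Tdep_compl_eq (u v : ℝ) (c : Fin 24 → Matrix (Fin 2) (Fin 2) ℂ)
    (φ : Matrix (Fin 2) (Fin 2) ℂ) :
    (Tdep u v c).compl φ = (Matrix.reindex (Equiv.prodComm _ _) (Equiv.prodComm _ _)
      (Matrix.blockDiagonal fun k => ((24⁻¹ : ℝ) : ℂ) • Matrix.of fun s s' =>
        (twirledKraus u v c k s * φ * (twirledKraus u v c k s')ᴴ).trace) :
      Matrix (Fin 24 × Fin 2) (Fin 24 × Fin 2) ℂ) := by
  refine Matrix.ext (m := Fin 24 × Fin 2) (n := Fin 24 × Fin 2) fun x y => ?_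
  obtain ⟨k, s⟩ := x
  obtain ⟨k', s'⟩ := y
  change ((Tdep u v c).K (k, s) * φ * ((Tdep u v c).K (k', s'))ᴴ).trace = _
  have h : ∀ f, ((Tdep u v c).K (k, s) * φ * ((Tdep u v c).K (k', s'))ᴴ) f f =
      if f.2 = k ∧ f.2 = k' then ((24⁻¹ : ℝ) : ℂ) *
        (twirledKraus u v c k s * φ * (twirledKraus u v c k' s')ᴴ) f.1 f.1 else 0 := fun f => by
    rw [← inv_sqrt_mul_star]
    exact flagged_mul_mul_conjTranspose_apply _ _ _ _ _ _ _ _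
  rw [Matrix.trace]
  simp only [Matrix.diag_apply, h]
  rw [Fintype.sum_prod_type_right, Finset.sum_eq_single k]
  · by_cases hk : k = k'
    · subst hk
      simp [Matrix.blockDiagonal_apply, Matrix.trace]
      ring
    · simp [Matrix.blockDiagonal_apply, hk]
  · intro l _ hl
    simp [hl]
  · simp

lemma isHermitian_apply (N : KrausFamily A B) {ρ : Matrix A A ℂ} (h : ρ.IsHermitian) :
    (N.apply ρ).IsHermitian := by
  rw [KrausFamily.apply, Matrix.IsHermitian, Matrix.conjTranspose_sum]
  exact Finset.sum_congr rfl fun i _ => Matrix.isHermitian_mul_mul_conjTranspose _ h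

lemma isHermitian_compl (N : KrausFamily A B) {ρ : Matrix A A ℂ} (h : ρ.IsHermitian) :
    (N.compl ρ).IsHermitian := by
  ext i j
  rw [Matrix.conjTranspose_apply, KrausFamily.compl, Matrix.of_apply, Matrix.of_apply,
    ← Matrix.trace_conjTranspose, Matrix.conjTranspose_mul, Matrix.conjTranspose_mul,
    Matrix.conjTranspose_conjTranspose, h.eq, Matrix.mul_assoc]

lemma twirledKraus_mul_mul (u v : ℝ) (c : Fin 24 → Matrix (Fin 2) (Fin 2) ℂ)
    (φ : Matrix (Fin 2) (Fin 2) ℂ) (k : Fin 24) (s s' : Fin 2) :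
    twirledKraus u v c k s * φ * (twirledKraus u v c k s')ᴴ =
      (c k)ᴴ * ((![Aplus u v, Aminus u v] s * (c k * φ * (c k)ᴴ) *
        (![Aplus u v, Aminus u v] s')ᴴ) * c k) := by
  simp only [twirledKraus, Matrix.conjTranspose_mul, Matrix.conjTranspose_conjTranspose, mul_assoc]

section HalfAngle

variable (u v : ℝ)

lemma cos_eq_half_angle : Real.cos u =
    Real.cos ((v - u) / 2) * Real.cos ((v + u) / 2) +
      Real.sin ((v + u) / 2) * Real.sin ((v - u) / 2) := by
  have := Real.cos_sub ((v + u) / 2) ((v - u) / 2)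
  rw [show (v + u) / 2 - (v - u) / 2 = u by ring] at this
  linarith

lemma cos_eq_half_angle' : Real.cos v =
    Real.cos ((v - u) / 2) * Real.cos ((v + u) / 2) -
      Real.sin ((v + u) / 2) * Real.sin ((v - u) / 2) := by
  have := Real.cos_add ((v + u) / 2) ((v - u) / 2)
  rw [show (v + u) / 2 + (v - u) / 2 = v by ring] at this
  linarith

lemma sin_eq_half_angle : Real.sin u =
    Real.sin ((v + u) / 2) * Real.cos ((v - u) / 2) -
      Real.cos ((v + u) / 2) * Real.sin ((v - u) / 2) := by
  have := Real.sin_sub ((v + u) / 2) ((v - u) / 2)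
  rwa [show (v + u) / 2 - (v - u) / 2 = u by ring] at this

lemma sin_eq_half_angle' : Real.sin v =
    Real.sin ((v + u) / 2) * Real.cos ((v - u) / 2) +
      Real.cos ((v + u) / 2) * Real.sin ((v - u) / 2) := by
  have := Real.sin_add ((v + u) / 2) ((v - u) / 2)
  rwa [show (v + u) / 2 + (v - u) / 2 = v by ring] at this

end HalfAngle

lemma Aplus_conjTranspose (u v : ℝ) : (Aplus u v)ᴴ = Aplus u v := by
  ext i j
  fin_cases i <;> fin_cases j <;>
    simp [Aplus, Matrix.conjTranspose_apply, Complex.conj_ofReal, -Complex.ofReal_cos]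

lemma Aminus_conjTranspose (u v : ℝ) : (Aminus u v)ᴴ =
    !![0, ((Real.sin ((v - u) / 2) : ℝ) : ℂ); ((Real.sin ((v + u) / 2) : ℝ) : ℂ), 0] := by
  ext i j
  fin_cases i <;> fin_cases j <;>
    simp [Aminus, Matrix.conjTranspose_apply, Complex.conj_ofReal, -Complex.ofReal_sin]

open Polynomial in
lemma charpoly_Tdep_apply_block {u v : ℝ} {c : Fin 24 → Matrix (Fin 2) (Fin 2) ℂ} {k : Fin 24}
    (hc : c k ∈ Matrix.unitaryGroup (Fin 2) ℂ) {φ : Matrix (Fin 2) (Fin 2) ℂ} {x y z : ℝ}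
    (h : c k * φ * (c k)ᴴ = blochMatrix x y z) (p : ℝ) :
    ((p : ℂ) • ∑ s, twirledKraus u v c k s * φ * (twirledKraus u v c k s)ᴴ).charpoly =
      X ^ 2 - C (p : ℂ) * X +
        C ((p ^ 2 * (1 - outNormSq u v (x ^ 2) (y ^ 2) z) / 4 : ℝ) : ℂ) := by
  simp only [twirledKraus_mul_mul, h]
  rw [← Finset.mul_sum, ← Finset.sum_mul, ← mul_smul_comm, ← smul_mul_assoc,
    Matrix.charpoly_mul_comm, mul_assoc, ← Matrix.star_eq_conjTranspose (c k),
    Matrix.mem_unitaryGroup_iff.1 hc, mul_one, outNormSq, cos_eq_half_angle u v,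
    cos_eq_half_angle' u v, sin_eq_half_angle u v, sin_eq_half_angle' u v]
  rw [← charpoly_smul_output (Real.cos_sq_add_sin_sq _) (Real.cos_sq_add_sin_sq _)]
  congr 2
  simp only [Fin.sum_univ_two, Matrix.cons_val_zero, Matrix.cons_val_one, Aplus_conjTranspose,
    Aminus_conjTranspose]
  ext i j
  fin_cases i <;> fin_cases j <;>
    simp [Aplus, Aminus, blochMatrix, -Complex.ofReal_cos, -Complex.ofReal_sin] <;> ring

open Polynomial in
lemma charpoly_Tdep_compl_block {u v : ℝ} {c : Fin 24 → Matrix (Fin 2) (Fin 2) ℂ} {k : Fin 24}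
    (hc : c k ∈ Matrix.unitaryGroup (Fin 2) ℂ) {φ : Matrix (Fin 2) (Fin 2) ℂ} {x y z : ℝ}
    (h : c k * φ * (c k)ᴴ = blochMatrix x y z) (p : ℝ) :
    ((p : ℂ) • Matrix.of fun s s' =>
        (twirledKraus u v c k s * φ * (twirledKraus u v c k s')ᴴ).trace).charpoly =
      X ^ 2 - C (p : ℂ) * X +
        C ((p ^ 2 * (1 - envNormSq u v (x ^ 2) (y ^ 2) z) / 4 : ℝ) : ℂ) := by
  have e : envNormSq u v (x ^ 2) (y ^ 2) z =
      (Real.cos ((v - u) / 2) * Real.sin ((v + u) / 2) +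
        Real.cos ((v + u) / 2) * Real.sin ((v - u) / 2)) ^ 2 * x ^ 2 +
      (Real.cos ((v - u) / 2) * Real.sin ((v + u) / 2) -
        Real.cos ((v + u) / 2) * Real.sin ((v - u) / 2)) ^ 2 * y ^ 2 +
      ((Real.cos ((v - u) / 2) * Real.sin ((v + u) / 2) +
        Real.cos ((v + u) / 2) * Real.sin ((v - u) / 2)) *
       (Real.cos ((v - u) / 2) * Real.sin ((v + u) / 2) -
        Real.cos ((v + u) / 2) * Real.sin ((v - u) / 2)) * z +
       (Real.cos ((v + u) / 2) * Real.cos ((v - u) / 2) -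
        Real.sin ((v + u) / 2) * Real.sin ((v - u) / 2)) *
       (Real.cos ((v + u) / 2) * Real.cos ((v - u) / 2) +
        Real.sin ((v + u) / 2) * Real.sin ((v - u) / 2))) ^ 2 := by
    rw [envNormSq, cos_eq_half_angle u v, cos_eq_half_angle' u v, sin_eq_half_angle u v,
      sin_eq_half_angle' u v]
    ring
  rw [e, ← charpoly_smul_output (Real.cos_sq_add_sin_sq _) (Real.sin_sq_add_cos_sq _)]
  congr 2
  ext s s'
  rw [Matrix.of_apply, twirledKraus_mul_mul, h, Matrix.trace_mul_comm, mul_assoc,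
    ← Matrix.star_eq_conjTranspose (c k), Matrix.mem_unitaryGroup_iff.1 hc, mul_one]
  fin_cases s <;> fin_cases s' <;>
    simp only [Fin.zero_eta, Fin.mk_one, Matrix.cons_val_zero, Matrix.cons_val_one,
      Aplus_conjTranspose, Aminus_conjTranspose] <;>
    simp [Matrix.trace_fin_two, Aplus, Aminus, blochMatrix, -Complex.ofReal_cos,
      -Complex.ofReal_sin] <;> ring

lemma cohInfo_Tdep_eq {u v : ℝ} {c : Fin 24 → Matrix (Fin 2) (Fin 2) ℂ}
    (hc : ∀ k, c k ∈ Matrix.unitaryGroup (Fin 2) ℂ) {φ : Matrix (Fin 2) (Fin 2) ℂ}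
    (hφ : φ.IsHermitian) {x y z : Fin 24 → ℝ}
    (h : ∀ k, c k * φ * (c k)ᴴ = blochMatrix (x k) (y k) (z k)) :
    cohInfo (Tdep u v c) φ = 24⁻¹ / Real.log 2 * ∑ k,
      (qubitDeficit (envNormSq u v (x k ^ 2) (y k ^ 2) (z k)) -
        qubitDeficit (outNormSq u v (x k ^ 2) (y k ^ 2) (z k))) := by
  have h1 : vnEntropy ((Tdep u v c).apply φ) = _ :=
    vnEntropy_eq_of_charpoly_eq_prod (isHermitian_apply _ hφ) (p := 24⁻¹) (by norm_num)
      (w := fun k => outNormSq u v (x k ^ 2) (y k ^ 2) (z k))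
      (fun k => outNormSq_nonneg (sq_nonneg _) (sq_nonneg _)) (by
        rw [Tdep_apply_eq, charpoly_blockDiagonal]
        exact Finset.prod_congr rfl fun k _ => charpoly_Tdep_apply_block (hc k) (h k) _)
  have h2 : vnEntropy ((Tdep u v c).compl φ) = _ :=
    vnEntropy_eq_of_charpoly_eq_prod (isHermitian_compl _ hφ) (p := 24⁻¹) (by norm_num)
      (w := fun k => envNormSq u v (x k ^ 2) (y k ^ 2) (z k))
      (fun k => envNormSq_nonneg (sq_nonneg _) (sq_nonneg _)) (by
        rw [Tdep_compl_eq]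
        refine (Matrix.charpoly_reindex _ _).trans ?_
        rw [charpoly_blockDiagonal]
        exact Finset.prod_congr rfl fun k _ => charpoly_Tdep_compl_block (hc k) (h k) _)
  rw [cohInfo, h1, h2, ← Finset.sum_sub_distrib, Finset.mul_sum]
  exact Finset.sum_congr rfl fun k _ => by ring

lemma inv_sqrt_two_mul_self : ((Real.sqrt 2)⁻¹ : ℂ) * ((Real.sqrt 2 : ℂ))⁻¹ = 2⁻¹ := by
  rw [← mul_inv, ← Complex.ofReal_mul, Real.mul_self_sqrt (by norm_num), Complex.ofReal_ofNat]

lemma pauliX_mem_closure :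
    !![0, 1; 1, 0] ∈ Submonoid.closure {Had, Sgate} := by
  have hH : Had ∈ Submonoid.closure {Had, Sgate} := Submonoid.subset_closure (by simp)
  have hS : Sgate ∈ Submonoid.closure {Had, Sgate} := Submonoid.subset_closure (by simp)
  have e : Had * (Sgate * Sgate) * Had = !![0, 1; 1, 0] := by
    rw [Had, Sgate, smul_mul_assoc, smul_mul_smul_comm, inv_sqrt_two_mul_self]
    ext i j
    fin_cases i <;> fin_cases j <;> simp <;> norm_num
  rw [← e]
  exact mul_mem (mul_mem hH (mul_mem hS hS)) hH

lemma closure_Had_Sgate_le_unitaryGroup :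
    Submonoid.closure {Had, Sgate} ≤ Matrix.unitaryGroup (Fin 2) ℂ := by
  rw [Submonoid.closure_le]
  rintro _ (rfl | rfl)
  · have hs : star (!![1, 1; 1, -1] : Matrix (Fin 2) (Fin 2) ℂ) = !![1, 1; 1, -1] := by
      ext i j
      fin_cases i <;> fin_cases j <;> simp [Matrix.star_apply]
    rw [SetLike.mem_coe, Matrix.mem_unitaryGroup_iff, Had, star_smul, hs, smul_mul_smul_comm,
      Complex.star_def, map_inv₀, Complex.conj_ofReal, inv_sqrt_two_mul_self]
    ext i j
    fin_cases i <;> fin_cases j <;> simp <;> norm_num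
  · rw [SetLike.mem_coe, Matrix.mem_unitaryGroup_iff, Sgate]
    ext i j
    fin_cases i <;> fin_cases j <;> simp [Matrix.mul_apply, Fin.sum_univ_two]

lemma mul_star_eq_one_of_smul_mem_unitaryGroup {V : Matrix (Fin 2) (Fin 2) ℂ} {z : ℂ}
    (hV : V ∈ Matrix.unitaryGroup (Fin 2) ℂ) (h : z • V ∈ Matrix.unitaryGroup (Fin 2) ℂ) :
    z * star z = 1 := by
  rw [Matrix.mem_unitaryGroup_iff, star_smul, smul_mul_smul_comm,
    Matrix.mem_unitaryGroup_iff.1 hV] at h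
  simpa using congrFun₂ h 0 0

lemma smul_mul_mul_conjTranspose_smul {z : ℂ} (hz : z * star z = 1)
    (V φ : Matrix (Fin 2) (Fin 2) ℂ) : z • V * φ * (z • V)ᴴ = V * φ * Vᴴ := by
  rw [Matrix.conjTranspose_smul, smul_mul_assoc, smul_mul_smul_comm, hz, one_smul]

/-- Left multiplication by a Clifford group element permutes a Clifford family up to phases. -/
lemma IsCliffordFamily.exists_perm {c : Fin 24 → Matrix (Fin 2) (Fin 2) ℂ}
    (hc : IsCliffordFamily c) {g : Matrix (Fin 2) (Fin 2) ℂ}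
    (hg : g ∈ Submonoid.closure {Had, Sgate}) :
    ∃ σ : Equiv.Perm (Fin 24), ∀ k φ,
      c (σ k) * φ * (c (σ k))ᴴ = g * (c k * φ * (c k)ᴴ) * gᴴ := by
  obtain ⟨hu, hmem, huniq⟩ := hc
  have hle := closure_Had_Sgate_le_unitaryGroup
  choose z hz using hmem
  choose σ hσ using fun k => (huniq _ (mul_mem hg (hz k))).exists
  choose w hw using hσ
  have hz1 : ∀ k, z k * star (z k) = 1 := fun k =>
    mul_star_eq_one_of_smul_mem_unitaryGroup (hu k) (hle (hz k))
  have hw1 : ∀ k, w k * star (w k) = 1 := fun k =>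
    mul_star_eq_one_of_smul_mem_unitaryGroup (hu (σ k)) (hw k ▸ hle (mul_mem hg (hz k)))
  have hinj : Function.Injective σ := fun i j hij => by
    refine (huniq _ (hz i)).unique ⟨z i, rfl⟩ ⟨w i * star (w j) * z j, ?_⟩
    have hgg : gᴴ * g = 1 := Matrix.mem_unitaryGroup_iff'.1 (hle hg)
    have h : g * (z i • c i) = (w i * star (w j)) • (g * (z j • c j)) := by
      rw [hw i, hw j, hij, smul_smul, mul_assoc, mul_comm (star _), hw1, mul_one]
    have := congrArg (gᴴ * ·) h
    simpa only [mul_smul_comm, ← mul_assoc, hgg, one_mul, smul_smul] using this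
  refine ⟨Equiv.ofBijective σ (Finite.injective_iff_bijective.1 hinj), fun k φ => ?_⟩
  rw [Equiv.ofBijective_apply, ← smul_mul_mul_conjTranspose_smul (hw1 k), ← hw,
    Matrix.conjTranspose_mul, ← smul_mul_mul_conjTranspose_smul (hz1 k) (c k)]
  simp only [mul_assoc]

lemma blochMatrix_injective {x y z x' y' z' : ℝ} (h : blochMatrix x y z = blochMatrix x' y' z') :
    x = x' ∧ y = y' ∧ z = z' := by
  have h0 := congrFun₂ h 0 0
  have h1 := congrFun₂ h 1 0
  simp [blochMatrix, Complex.ext_iff] at h0 h1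
  exact ⟨h1.1, h1.2, h0⟩

lemma pauliX_mul_blochMatrix_mul (x y z : ℝ) :
    !![0, 1; 1, 0] * blochMatrix x y z * (!![0, 1; 1, 0] : Matrix (Fin 2) (Fin 2) ℂ)ᴴ =
      blochMatrix x (-y) (-z) := by
  ext i j
  fin_cases i <;> fin_cases j <;> simp [blochMatrix, Matrix.mul_apply, Fin.sum_univ_two] <;> ring

/-- For reals `u, v` with `|sin v| ≤ |cos u|`, the coherent information
of the flagged channel `T^dep_(u,v)` is maximized by the maximally mixed state: for every
one-qubit density matrix `φ`, `I^c(T^dep_(u,v), φ) ≤ I^c(T^dep_(u,v), I/2)`. -/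
theorem cohInfo_Tdep_le_maximally_mixed (u v : ℝ) (huv : |Real.sin v| ≤ |Real.cos u|)
    (c : Fin 24 → Matrix (Fin 2) (Fin 2) ℂ) (hc : IsCliffordFamily c)
    (φ : Matrix (Fin 2) (Fin 2) ℂ) (hφ : IsDensity φ) :
    cohInfo (Tdep u v c) φ ≤ cohInfo (Tdep u v c) (((2 : ℂ)⁻¹) • 1) := by
  obtain ⟨σ, hσ⟩ := hc.exists_perm pauliX_mem_closure
  choose x y z hxyz hr using fun k => (hφ.conj (hc.1 k)).exists_blochMatrix
  have hmix : ∀ k, c k * ((2 : ℂ)⁻¹ • 1) * (c k)ᴴ = blochMatrix 0 0 0 := fun k => by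
    rw [mul_smul_comm, mul_one, smul_mul_assoc, ← Matrix.star_eq_conjTranspose,
      Matrix.mem_unitaryGroup_iff.1 (hc.1 k)]
    ext i j
    fin_cases i <;> fin_cases j <;> simp [blochMatrix]
  have hflip : ∀ k, c (σ k) * φ * (c (σ k))ᴴ = blochMatrix (x k) (-y k) (-z k) := fun k => by
    rw [hσ, hxyz, pauliX_mul_blochMatrix_mul]
  have hherm : ((2 : ℂ)⁻¹ • (1 : Matrix (Fin 2) (Fin 2) ℂ)).IsHermitian := by
    simp [Matrix.IsHermitian, Matrix.conjTranspose_smul]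
  have hrefl : ∀ k, x (σ k) ^ 2 = x k ^ 2 ∧ y (σ k) ^ 2 = y k ^ 2 ∧ z (σ k) = -z k := fun k => by
    obtain ⟨hx, hy, hz⟩ := blochMatrix_injective ((hxyz (σ k)).symm.trans (hflip k))
    simp [hx, hy, hz]
  rw [cohInfo_Tdep_eq hc.1 hφ.1.isHermitian hxyz, cohInfo_Tdep_eq hc.1 hherm hmix]
  refine mul_le_mul_of_nonneg_left ?_ (div_nonneg (by norm_num) (Real.log_nonneg (by norm_num)))
  have hsum := Equiv.sum_comp σ fun k =>
    qubitDeficit (envNormSq u v (x k ^ 2) (y k ^ 2) (z k)) -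
      qubitDeficit (outNormSq u v (x k ^ 2) (y k ^ 2) (z k))
  have hle := Finset.sum_le_sum fun k (_ : k ∈ Finset.univ) =>
    qubitDeficit_gap_add_reflect_le huv (sq_nonneg (x k)) (sq_nonneg (y k)) (hr k)
  simp only [hrefl] at hsum
  rw [Finset.sum_add_distrib, hsum, ← Finset.mul_sum] at hle
  simp only [zero_pow two_ne_zero]
  linarith
end

section
/- For all reals u, v, the entanglement fidelity of the channel N_(u,v) equals cos²(u/2)·cos²(v/2): ⟨φ⁺| (I⊗N_(u,v))(|φ⁺⟩⟨φ⁺|) |φ⁺⟩ = cos²(u/2)·cos²(v/2). -/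
open scoped Matrix Kronecker ComplexOrder

variable {A B : Type} [Fintype A] [DecidableEq A] [Fintype B] [DecidableEq B]

/-- The maximally entangled two-qubit state `|φ⁺⟩ = (1/√2)(|00⟩ + |11⟩)`. -/
noncomputable def phiPlus : Fin 2 × Fin 2 → ℂ :=
  fun x => if x.1 = x.2 then ((Real.sqrt 2)⁻¹ : ℂ) else 0

/-- The channel `I ⊗ N`, with Kraus operators `I ⊗ Kᵢ`. -/
noncomputable def idTensor (N : KrausFamily (Fin 2) (Fin 2)) :
    KrausFamily (Fin 2 × Fin 2) (Fin 2 × Fin 2) where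
  ι := N.ι
  K i := (1 : Matrix (Fin 2) (Fin 2) ℂ) ⊗ₖ N.K i

/-- The entanglement fidelity `⟨φ⁺| (I ⊗ N)(|φ⁺⟩⟨φ⁺|) |φ⁺⟩` of a qubit channel `N`. -/
noncomputable def entFid (N : KrausFamily (Fin 2) (Fin 2)) : ℂ :=
  star phiPlus ⬝ᵥ ((idTensor N).apply (Matrix.vecMulVec phiPlus (star phiPlus)) *ᵥ phiPlus)

/-- The expectation of `1 ⊗ K` in the maximally entangled state is half the trace of `K`. -/
lemma star_phiPlus_dotProduct_kronecker_mulVec (K : Matrix (Fin 2) (Fin 2) ℂ) :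
    star phiPlus ⬝ᵥ (((1 : Matrix (Fin 2) (Fin 2) ℂ) ⊗ₖ K) *ᵥ phiPlus) = K.trace / 2 := by
  have h : ((Real.sqrt 2 : ℂ)⁻¹) * (Real.sqrt 2 : ℂ)⁻¹ = 1 / 2 := by
    rw [← mul_inv, ← Complex.ofReal_mul, Real.mul_self_sqrt zero_le_two]
    norm_num
  simp only [dotProduct, Matrix.mulVec, Fintype.sum_prod_type, Fin.sum_univ_two, Pi.star_apply,
    phiPlus, Matrix.trace, Matrix.diag]
  simp
  linear_combination (K 0 0 + K 1 1) * h

/-- The entanglement fidelity of a qubit channel is `¼ ∑ |Tr Kᵢ|²`. -/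
lemma entFid_eq_sum_trace (N : KrausFamily (Fin 2) (Fin 2)) :
    entFid N = ∑ i, (N.K i).trace / 2 * star ((N.K i).trace / 2) := by
  have key (M : Matrix (Fin 2 × Fin 2) (Fin 2 × Fin 2) ℂ) :
      star phiPlus ⬝ᵥ ((M * Matrix.vecMulVec phiPlus (star phiPlus) * Mᴴ) *ᵥ phiPlus) =
        (star phiPlus ⬝ᵥ (M *ᵥ phiPlus)) * star (star phiPlus ⬝ᵥ (M *ᵥ phiPlus)) := by
    rw [Matrix.mul_vecMulVec, Matrix.vecMulVec_mul, Matrix.vecMulVec_mulVec, dotProduct_smul,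
      ← Matrix.star_mulVec, Matrix.star_dotProduct (M *ᵥ phiPlus)]
    rfl
  rw [entFid, KrausFamily.apply, Matrix.sum_mulVec, dotProduct_sum]
  refine Finset.sum_congr rfl fun i _ => ?_
  rw [key, ← star_phiPlus_dotProduct_kronecker_mulVec]
  rfl

/-- For all reals `u, v`, the entanglement fidelity of `N_(u,v)` equals
`cos²(u/2) cos²(v/2)`. -/
theorem entFid_Nuv (u v : ℝ) :
    entFid (Nuv u v) = ((Real.cos (u / 2) ^ 2 * Real.cos (v / 2) ^ 2 : ℝ) : ℂ) := by
  have hp : (Aplus u v).trace / 2 = ((Real.cos (u / 2) * Real.cos (v / 2) : ℝ) : ℂ) := by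
    rw [Aplus, Matrix.trace_fin_two_of, sub_div v, add_div v, Real.cos_sub, Real.cos_add]
    push_cast
    ring
  have hm : (Aminus u v).trace = 0 := by simp [Aminus, Matrix.trace_fin_two_of]
  rw [entFid_eq_sum_trace]
  change ∑ i : Fin 2, (![Aplus u v, Aminus u v] i).trace / 2 *
    star ((![Aplus u v, Aminus u v] i).trace / 2) = _
  simp only [Fin.sum_univ_two, Matrix.cons_val_zero, Matrix.cons_val_one, hp, hm,
    Complex.star_def, Complex.conj_ofReal, zero_div, zero_mul, add_zero]
  push_cast
  ring
end
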